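/- There exists a geometric (18_4) configuration (P, L) together with partitions P = P₁ ⊔ P₂ and L = L₁ ⊔ L₂ such that |P₁| = |P₂| = |L₁| = |L₂| = 9 and, for each i ∈ {1, 2}, every point of Pᵢ is incident to 3 or 4 lines of Lᵢ and every line of Lᵢ is incident to 3 or 4 points of Pᵢ; that is, the (18_4) configuration splits into two geometric (9_{3|4}) configurations. -/

import Mathlib

/- Model of the real projective plane: a point is a 1-dimensional linear subspace
of ℝ³ and a line is a 2-dimensional linear subspace of ℝ³; a point p is incident
to a line ℓ when p ≤ ℓ. -/

open scoped Classical

/-- The degree of a point `p` with respect to a finite set `L` of lines: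
the number of lines of `L` incident to `p`. -/
noncomputable def pointDeg (L : Finset (Submodule ℝ (Fin 3 → ℝ)))
    (p : Submodule ℝ (Fin 3 → ℝ)) : ℕ :=
  (L.filter fun l => p ≤ l).card

/-- The degree of a line `l` with respect to a finite set `P` of points:
the number of points of `P` incident to `l`. -/
noncomputable def lineDeg (P : Finset (Submodule ℝ (Fin 3 → ℝ)))
    (l : Submodule ℝ (Fin 3 → ℝ)) : ℕ :=
  (P.filter fun p => p ≤ l).card

/-- The number of incidences of `(P, L)`: the number of pairs `(p, ℓ) ∈ P × L`
with `p` incident to `ℓ`. -/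
noncomputable def incCount (P L : Finset (Submodule ℝ (Fin 3 → ℝ))) : ℕ :=
  ((P ×ˢ L).filter fun pl => pl.1 ≤ pl.2).card

/-- A point of the real projective plane: a 1-dimensional linear subspace of ℝ³. -/
def IsProjPoint (p : Submodule ℝ (Fin 3 → ℝ)) : Prop := Module.finrank ℝ p = 1

/-- A line of the real projective plane: a 2-dimensional linear subspace of ℝ³. -/
def IsProjLine (l : Submodule ℝ (Fin 3 → ℝ)) : Prop := Module.finrank ℝ l = 2

/-- The embedding of `ℤ[√5]` into `ℝ`. -/
noncomputable def sqrtFiveEmbedding : ℤ√5 →+* ℝ :=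
  Zsqrtd.lift ⟨√5, by norm_num⟩

theorem sqrtFiveEmbedding_injective : Function.Injective sqrtFiveEmbedding := by
  refine Zsqrtd.lift_injective _ fun n h => ?_
  have h₁ : n.natAbs * n.natAbs = 5 := by
    zify
    rw [abs_mul_abs_self]
    exact h.symm
  have h₂ : n.natAbs < 3 := by nlinarith
  interval_cases n.natAbs <;> omega

/-- The real vector with given coordinates in `ℤ[√5]`. -/
noncomputable def realVec (v : Fin 3 → ℤ√5) : Fin 3 → ℝ := fun c => sqrtFiveEmbedding (v c)

theorem realVec_ne_zero {v : Fin 3 → ℤ√5} (hv : v ≠ 0) : realVec v ≠ 0 := by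
  refine fun h => hv (funext fun c => sqrtFiveEmbedding_injective ?_)
  simpa [realVec] using congrFun h c

theorem realVec_dotProduct_eq_zero {v w : Fin 3 → ℤ√5} :
    realVec w ⬝ᵥ realVec v = 0 ↔ w ⬝ᵥ v = 0 := by
  have h : realVec w ⬝ᵥ realVec v = sqrtFiveEmbedding (w ⬝ᵥ v) := by
    simp [realVec, dotProduct]
  rw [h, map_eq_zero_iff _ sqrtFiveEmbedding_injective]

/-- The point of the projective plane spanned by a vector. -/
noncomputable def projPoint (v : Fin 3 → ℝ) : Submodule ℝ (Fin 3 → ℝ) := Submodule.span ℝ {v}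

/-- The line of the projective plane with a given normal vector. -/
noncomputable def projLine (w : Fin 3 → ℝ) : Submodule ℝ (Fin 3 → ℝ) :=
  LinearMap.ker (dotProductBilin ℝ ℝ w)

theorem isProjPoint_projPoint {v : Fin 3 → ℝ} (hv : v ≠ 0) : IsProjPoint (projPoint v) :=
  finrank_span_singleton hv

theorem isProjLine_projLine {w : Fin 3 → ℝ} (hw : w ≠ 0) : IsProjLine (projLine w) := by
  have hne : (dotProductBilin ℝ ℝ w : (Fin 3 → ℝ) →ₗ[ℝ] ℝ) ≠ 0 := fun h =>
    hw (dotProduct_self_eq_zero.mp (by simpa using LinearMap.congr_fun h w))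
  have h := Module.Dual.finrank_ker_add_one_of_ne_zero (f := dotProductBilin ℝ ℝ w) hne
  rw [Module.finrank_fin_fun] at h
  exact Nat.succ_injective h

theorem projPoint_le_projLine {v w : Fin 3 → ℝ} : projPoint v ≤ projLine w ↔ w ⬝ᵥ v = 0 := by
  simp [projPoint, projLine, Submodule.span_le]

/-- Representatives, up to cyclic permutation of the coordinates, of the points of the
configuration. -/
def basePoint : Fin 6 → Fin 3 → ℤ√5 :=
  ![![1, 0, 0], ![1, -1, -1], ![0, 2, ⟨-1, 1⟩], ![1, -1, 0], ![2, 2, ⟨-1, 1⟩], ![1, ⟨0, 1⟩, 1]]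

/-- Representatives, up to cyclic permutation of the coordinates, of the normal vectors of the
lines of the configuration. -/
def baseLine : Fin 6 → Fin 3 → ℤ√5 :=
  ![![1, 1, ⟨-1, -1⟩], ![2, 2, ⟨-1, -1⟩], ![2, ⟨-1, -1⟩, ⟨3, 1⟩], ![0, 1, -1], ![0, 1, 1],
    ![0, 1, 0]]

/-- Homogeneous coordinates of the points of the configuration. -/
def pointCoord (i : Fin 6 × Fin 3) : Fin 3 → ℤ√5 := fun c => basePoint i.1 (c + i.2)

/-- Normal vectors of the lines of the configuration. -/
def lineCoord (j : Fin 6 × Fin 3) : Fin 3 → ℤ√5 := fun c => baseLine j.1 (c + j.2)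

/-- The points of the configuration. -/
noncomputable def configPoint (i : Fin 6 × Fin 3) : Submodule ℝ (Fin 3 → ℝ) :=
  projPoint (realVec (pointCoord i))

/-- The lines of the configuration. -/
noncomputable def configLine (j : Fin 6 × Fin 3) : Submodule ℝ (Fin 3 → ℝ) :=
  projLine (realVec (lineCoord j))

/-- Incidence of the configuration, expressed in coordinates. -/
def Incident (i j : Fin 6 × Fin 3) : Prop := lineCoord j ⬝ᵥ pointCoord i = 0

instance (i j : Fin 6 × Fin 3) : Decidable (Incident i j) :=
  inferInstanceAs (Decidable (_ = _))

theorem configPoint_le_configLine {i j : Fin 6 × Fin 3} :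
    configPoint i ≤ configLine j ↔ Incident i j :=
  projPoint_le_projLine.trans realVec_dotProduct_eq_zero

theorem configPoint_injective : Function.Injective configPoint := by
  have key : ∀ i i', (∀ j, Incident i j ↔ Incident i' j) → i = i' := by decide +kernel
  exact fun i i' h => key i i' fun j => by
    rw [← configPoint_le_configLine, h, configPoint_le_configLine]

theorem configLine_injective : Function.Injective configLine := by
  have key : ∀ j j', (∀ i, Incident i j ↔ Incident i j') → j = j' := by decide +kernel
  exact fun j j' h => key j j' fun i => by
    rw [← configPoint_le_configLine, h, configPoint_le_configLine]

theorem Finset.card_filter_image_of_injective {α β : Type*} [DecidableEq β] {f : α → β}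
    (hf : Function.Injective f) (s : Finset α) {p : β → Prop} {q : α → Prop} [DecidablePred p]
    [DecidablePred q] (h : ∀ a, p (f a) ↔ q a) :
    ((s.image f).filter p).card = (s.filter q).card := by
  rw [Finset.filter_image, Finset.card_image_of_injective _ hf]
  simp only [h]

theorem pointDeg_image_configLine (B : Finset (Fin 6 × Fin 3)) (i : Fin 6 × Fin 3) :
    pointDeg (B.image configLine) (configPoint i) = (B.filter (Incident i)).card :=
  Finset.card_filter_image_of_injective configLine_injective B
    fun _ => configPoint_le_configLine

theorem lineDeg_image_configPoint (A : Finset (Fin 6 × Fin 3)) (j : Fin 6 × Fin 3) :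
    lineDeg (A.image configPoint) (configLine j) = (A.filter (Incident · j)).card :=
  Finset.card_filter_image_of_injective configPoint_injective A
    fun _ => configPoint_le_configLine

/-- The points of one half of the configuration. -/
def halfPoints : Finset (Fin 6 × Fin 3) :=
  {(0, 0), (0, 1), (0, 2), (1, 0), (2, 0), (2, 1), (3, 0), (3, 1), (4, 2)}

/-- The lines of one half of the configuration. -/
def halfLines : Finset (Fin 6 × Fin 3) :=
  {(1, 0), (1, 1), (2, 0), (3, 0), (4, 1), (4, 2), (5, 0), (5, 1), (5, 2)}

theorem stmt9 :
    ∃ P L P₁ P₂ L₁ L₂ : Finset (Submodule ℝ (Fin 3 → ℝ)),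
      (∀ p ∈ P, IsProjPoint p) ∧ (∀ l ∈ L, IsProjLine l) ∧
      P.card = 18 ∧ L.card = 18 ∧
      (∀ p ∈ P, pointDeg L p = 4) ∧ (∀ l ∈ L, lineDeg P l = 4) ∧
      Disjoint P₁ P₂ ∧ P₁ ∪ P₂ = P ∧ Disjoint L₁ L₂ ∧ L₁ ∪ L₂ = L ∧
      P₁.card = 9 ∧ P₂.card = 9 ∧ L₁.card = 9 ∧ L₂.card = 9 ∧
      (∀ p ∈ P₁, pointDeg L₁ p = 3 ∨ pointDeg L₁ p = 4) ∧
      (∀ l ∈ L₁, lineDeg P₁ l = 3 ∨ lineDeg P₁ l = 4) ∧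
      (∀ p ∈ P₂, pointDeg L₂ p = 3 ∨ pointDeg L₂ p = 4) ∧
      (∀ l ∈ L₂, lineDeg P₂ l = 3 ∨ lineDeg P₂ l = 4) := by
  have hP := configPoint_injective
  have hL := configLine_injective
  refine ⟨Finset.univ.image configPoint, Finset.univ.image configLine,
    halfPoints.image configPoint, halfPointsᶜ.image configPoint,
    halfLines.image configLine, halfLinesᶜ.image configLine, ?_⟩
  simp only [Finset.forall_mem_image, pointDeg_image_configLine, lineDeg_image_configPoint,
    Finset.card_image_of_injective _ hP, Finset.card_image_of_injective _ hL,
    Finset.disjoint_image hP, Finset.disjoint_image hL, ← Finset.image_union,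
    Finset.union_compl, disjoint_compl_right, true_and]
  refine ⟨fun i _ => isProjPoint_projPoint (realVec_ne_zero ?_),
    fun j _ => isProjLine_projLine (realVec_ne_zero ?_), ?_⟩
  · revert i
    decide +kernel
  · revert j
    decide +kernel
  · decide +kernel
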